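/- arXiv:1905.02950 — 2 statements merged into one kernel-verified Lean document; each statement's English description precedes it below -/
import Mathlib

section
/- Let V be a finite-dimensional complex vector space with a Hermitian inner product h, let R be a curvature-type tensor on V, let K be the symmetrization of R, and let c be a real number. Then R(X, X, X, X) = c · h(X, X)² for every X ∈ V if and only if K(X, Y, Z, W) = (c/2) · (h(X, Y) h(Z, W) + h(X, W) h(Z, Y)) for all X, Y, Z, W ∈ V. (Equivalently: the holomorphic sectional curvature H(X) = R(X, X, X, X)/h(X, X)² equals c for all X ≠ 0 if and only if K has the above space-form shape.) -/
open scoped ComplexInnerProductSpace ComplexConjugate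

section Polarization

variable {V : Type*} [AddCommGroup V] [Module ℂ V] {F : V → V → V → V → ℂ}

/-- Polarization in one pair of conjugate slots: a form that is linear in its first and third
arguments, conjugate-linear in the others, and zero on the diagonal, vanishes at `(X, Y, X, Y)`. -/
lemma apply_alternating_eq_zero_of_diagonal
    (h1 : ∀ (a : ℂ) (X X' Y Z W : V), F (a • X + X') Y Z W = a * F X Y Z W + F X' Y Z W)
    (h2 : ∀ (a : ℂ) (X Y Y' Z W : V), F X (a • Y + Y') Z W = conj a * F X Y Z W + F X Y' Z W)
    (h3 : ∀ (a : ℂ) (X Y Z Z' W : V), F X Y (a • Z + Z') W = a * F X Y Z W + F X Y Z' W)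
    (h4 : ∀ (a : ℂ) (X Y Z W W' : V), F X Y Z (a • W + W') = conj a * F X Y Z W + F X Y Z W')
    (hF : ∀ X, F X X X X = 0) (X Y : V) : F X Y X Y = 0 := by
  have expand (t : ℂ) := hF (t • Y + X)
  simp only [h1, h2, h3, h4, hF] at expand
  have even (t : ℂ) : conj t ^ 2 * F X Y X Y + t ^ 2 * F Y X Y X
      + t * conj t * (F X X Y Y + F X Y Y X + F Y X X Y + F Y Y X X) = 0 := by
    have hp := expand t
    have hn := expand (-t)
    simp only [map_neg] at hn
    linear_combination (hp + hn) / 2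
  have e1 := even 1
  have e2 := even Complex.I
  have e3 := even (1 + Complex.I)
  have e4 := even (1 - Complex.I)
  simp only [map_one, map_add, map_sub, Complex.conj_I] at e1 e2 e3 e4
  have hI := Complex.I_sq
  have hsum : F X Y X Y + F Y X Y X = 0 := by
    linear_combination (e1 - e2) / 2 + (F X Y X Y + F Y X Y X
      - (F X X Y Y + F X Y Y X + F Y X X Y + F Y Y X X)) / 2 * hI
  have hdiff : F X Y X Y - F Y X Y X = 0 := by
    linear_combination Complex.I * (e3 - e4) / 4 + (F X Y X Y - F Y X Y X) * hI
  linear_combination (hsum + hdiff) / 2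

/-- A form that is linear in its first and third arguments, conjugate-linear in the others, and
symmetric in each of these pairs of arguments, is zero if it is zero on the diagonal. -/
lemma eq_zero_of_diagonal_eq_zero
    (h1 : ∀ (a : ℂ) (X X' Y Z W : V), F (a • X + X') Y Z W = a * F X Y Z W + F X' Y Z W)
    (h2 : ∀ (a : ℂ) (X Y Y' Z W : V), F X (a • Y + Y') Z W = conj a * F X Y Z W + F X Y' Z W)
    (h3 : ∀ (a : ℂ) (X Y Z Z' W : V), F X Y (a • Z + Z') W = a * F X Y Z W + F X Y Z' W)
    (h4 : ∀ (a : ℂ) (X Y Z W W' : V), F X Y Z (a • W + W') = conj a * F X Y Z W + F X Y Z W')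
    (h13 : ∀ X Y Z W, F X Y Z W = F Z Y X W) (h24 : ∀ X Y Z W, F X Y Z W = F X W Z Y)
    (hF : ∀ X, F X X X X = 0) (X Y Z W : V) : F X Y Z W = 0 := by
  have alternating := apply_alternating_eq_zero_of_diagonal h1 h2 h3 h4 hF
  have outer (X Y Z : V) : F X Y Z Y = 0 := by
    have h := alternating ((1 : ℂ) • X + Z) Y
    simp only [h1, h3, alternating] at h
    linear_combination h / 2 + h13 X Y Z Y / 2
  have h := outer X ((1 : ℂ) • Y + W) Z
  simp only [h2, h4, outer, map_one] at h
  linear_combination h / 2 + h24 X Y Z W / 2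

end Polarization

/-- Balas's characterization (pointwise): a curvature-type tensor `R` on a
finite-dimensional complex inner product space satisfies
`R(X,X̄,X,X̄) = c · h(X,X)²` for all `X` if and only if its symmetrization `K`
has the space-form shape `K(X,Ȳ,Z,W̄) = (c/2)(h(X,Y) h(Z,W) + h(X,W) h(Z,Y))`.
Here `h(X,Y)` (linear in the first slot) is `⟪Y, X⟫` in Mathlib's convention. -/
theorem stmt_1 {V : Type*} [NormedAddCommGroup V] [InnerProductSpace ℂ V]
    [FiniteDimensional ℂ V]
    (R : V → V → V → V → ℂ)
    (hR1 : ∀ (a : ℂ) (X X' Y Z W : V),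
      R (a • X + X') Y Z W = a * R X Y Z W + R X' Y Z W)
    (hR2 : ∀ (a : ℂ) (X Y Y' Z W : V),
      R X (a • Y + Y') Z W = conj a * R X Y Z W + R X Y' Z W)
    (hR3 : ∀ (a : ℂ) (X Y Z Z' W : V),
      R X Y (a • Z + Z') W = a * R X Y Z W + R X Y Z' W)
    (hR4 : ∀ (a : ℂ) (X Y Z W W' : V),
      R X Y Z (a • W + W') = conj a * R X Y Z W + R X Y Z W')
    (K : V → V → V → V → ℂ)
    (hK : ∀ X Y Z W : V, K X Y Z W =
      (R X Y Z W + R Z Y X W + R X W Z Y + R Z W X Y) / 4)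
    (c : ℝ) :
    (∀ X : V, R X X X X = (c : ℂ) * ⟪X, X⟫ ^ 2) ↔
      (∀ X Y Z W : V, K X Y Z W =
        ((c : ℂ) / 2) * (⟪Y, X⟫ * ⟪W, Z⟫ + ⟪W, X⟫ * ⟪Y, Z⟫)) := by
  constructor
  · intro h X Y Z W
    refine sub_eq_zero.mp (eq_zero_of_diagonal_eq_zero (F := fun X Y Z W ↦ K X Y Z W -
      ((c : ℂ) / 2) * (⟪Y, X⟫ * ⟪W, Z⟫ + ⟪W, X⟫ * ⟪Y, Z⟫)) ?_ ?_ ?_ ?_ ?_ ?_ ?_ X Y Z W)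
    case refine_7 =>
      intro X
      simp only [hK, h]
      ring
    all_goals
      intros
      simp only [hK, hR1, hR2, hR3, hR4, inner_add_left, inner_add_right, inner_smul_left,
        inner_smul_right]
      ring
  · intro h X
    linear_combination h X X X X - hK X X X X
end

section
/- Let n ≥ 1, let c be a nonzero real number, and for z ∈ ℂⁿ define the Hermitian inner product h̃_z(X, Y) = e^{c‖z‖²} ⟨X, Y⟩ on ℂⁿ (where ⟨·,·⟩ is the standard Hermitian inner product, linear in the first slot) and the curvature-type tensor R̃_z(X, Y, Z, W) = −c e^{c‖z‖²} ⟨X, Y⟩ ⟨Z, W⟩. Then for every z ∈ ℂⁿ: (i) the symmetrization K̃_z of R̃_z satisfies K̃_z(X, Y, Z, W) = −(c e^{−c‖z‖²}/2) · (h̃_z(X, Y) h̃_z(Z, W) + h̃_z(X, W) h̃_z(Z, Y)) for all X, Y, Z, W; (ii) consequently R̃_z(X, X, X, X) = −c e^{−c‖z‖²} · h̃_z(X, X)² for all X, so the holomorphic sectional curvature of R̃_z with respect to h̃_z is the constant −c e^{−c‖z‖²} at the point z; and (iii) for n ≥ 1 the function z ↦ −c e^{−c‖z‖²} is not constant on ℂⁿ.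 -/
open scoped ComplexInnerProductSpace

/-- Example 3.1: for the conformally flat metric `h̃_z = e^{c‖z‖²}⟨·,·⟩` on `ℂⁿ`
with curvature tensor `R̃_z(X,Ȳ,Z,W̄) = −c e^{c‖z‖²}⟨X,Y⟩⟨Z,W⟩`, the
symmetrization `K̃_z` has the space-form shape with factor `−c e^{−c‖z‖²}`, so
the holomorphic sectional curvature is the pointwise constant `−c e^{−c‖z‖²}`,
which is not a global constant. Here `⟨X,Y⟩` (linear in the first slot) is
`⟪Y, X⟫` in Mathlib's convention. -/
theorem stmt_7 (n : ℕ) (hn : 1 ≤ n) (c : ℝ) (hc : c ≠ 0)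
    (h : EuclideanSpace ℂ (Fin n) → EuclideanSpace ℂ (Fin n) →
      EuclideanSpace ℂ (Fin n) → ℂ)
    (R K : EuclideanSpace ℂ (Fin n) → EuclideanSpace ℂ (Fin n) →
      EuclideanSpace ℂ (Fin n) → EuclideanSpace ℂ (Fin n) →
      EuclideanSpace ℂ (Fin n) → ℂ)
    (hh : ∀ z X Y, h z X Y = (Real.exp (c * ‖z‖ ^ 2) : ℂ) * ⟪Y, X⟫)
    (hR : ∀ z X Y Z W, R z X Y Z W =
      -(c : ℂ) * (Real.exp (c * ‖z‖ ^ 2) : ℂ) * ⟪Y, X⟫ * ⟪W, Z⟫)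
    (hK : ∀ z X Y Z W, K z X Y Z W =
      (R z X Y Z W + R z Z Y X W + R z X W Z Y + R z Z W X Y) / 4) :
    (∀ z X Y Z W, K z X Y Z W =
      -(((c * Real.exp (-c * ‖z‖ ^ 2) : ℝ) : ℂ) / 2) *
        (h z X Y * h z Z W + h z X W * h z Z Y)) ∧
    (∀ z X, R z X X X X =
      -((c * Real.exp (-c * ‖z‖ ^ 2) : ℝ) : ℂ) * (h z X X) ^ 2) ∧
    ¬ (∀ z w : EuclideanSpace ℂ (Fin n),
        -c * Real.exp (-c * ‖z‖ ^ 2) = -c * Real.exp (-c * ‖w‖ ^ 2)) := by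
  have key : ∀ z : EuclideanSpace ℂ (Fin n), ((Real.exp (-c * ‖z‖ ^ 2) : ℝ) : ℂ) *
      ((Real.exp (c * ‖z‖ ^ 2) : ℝ) : ℂ) = 1 := by
    intro z
    rw [← Complex.ofReal_mul, ← Real.exp_add]
    simp
  refine ⟨fun z X Y Z W => ?_, fun z X => ?_, fun hconst => ?_⟩
  · simp only [hK, hR, hh, Complex.ofReal_mul]
    linear_combination ((c : ℂ) / 2 * ((Real.exp (c * ‖z‖ ^ 2) : ℝ) : ℂ) *
      (⟪Y, X⟫ * ⟪W, Z⟫ + ⟪W, X⟫ * ⟪Y, Z⟫)) * key z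
  · simp only [hR, hh, Complex.ofReal_mul]
    linear_combination ((c : ℂ) * ((Real.exp (c * ‖z‖ ^ 2) : ℝ) : ℂ) * ⟪X, X⟫ ^ 2) * key z
  · have hexp := mul_left_cancel₀ (neg_ne_zero.mpr hc)
      (hconst (EuclideanSpace.single ⟨0, hn⟩ 1) 0)
    have := Real.exp_injective hexp
    simp at this
    exact hc this
end
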